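/- Let x : U → ℝ³ be a wavefront, Ω a tmb of x, and p ∈ Σ(x) with rank(Dx(p)) = 1. If p is an isolated point of Σ(x), then x is parallelly smoothable at p. -/

import Mathlib

/- Common framework for frontals and tangent moving bases, following
   "Curvatures on fronts" conventions. -/

noncomputable section

open Matrix Topology Filter

/-- Points of the plane ℝ². -/
abbrev Pt : Type := Fin 2 → ℝ

/-- Jacobian matrix of a map `f : ℝ² → ℝ^m` at a point. -/
def jac {m : ℕ} (f : Pt → (Fin m → ℝ)) (p : Pt) : Matrix (Fin m) (Fin 2) ℝ :=
  Matrix.of fun i j => fderiv ℝ f p (Pi.single j 1) i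

/-- Euclidean norm of a vector in ℝ³. -/
def enorm3 (v : Fin 3 → ℝ) : ℝ := Real.sqrt (v ⬝ᵥ v)

/-- The unit normal vector field induced by a tangent moving base `Ω`,
    `n := (w₁ × w₂)/‖w₁ × w₂‖` where `w₁, w₂` are the columns of `Ω`. -/
def normalOf (Ω : Pt → Matrix (Fin 3) (Fin 2) ℝ) (p : Pt) : Fin 3 → ℝ :=
  (enorm3 (crossProduct (fun i => Ω p i 0) (fun i => Ω p i 1)))⁻¹ •
    crossProduct (fun i => Ω p i 0) (fun i => Ω p i 1)

/-- First fundamental form matrix of a map `y`. -/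
def IOf (y : Pt → Fin 3 → ℝ) (p : Pt) : Matrix (Fin 2) (Fin 2) ℝ :=
  (jac y p)ᵀ * jac y p

/-- Second fundamental form matrix of a map `y` with respect to a unit normal `ν`. -/
def IIOf (y ν : Pt → Fin 3 → ℝ) (p : Pt) : Matrix (Fin 2) (Fin 2) ℝ :=
  -((jac y p)ᵀ * jac ν p)

/-- Weingarten matrix `α := −IIᵀ I⁻¹` of a map `y` with unit normal `ν`. -/
def weinOf (y ν : Pt → Fin 3 → ℝ) (p : Pt) : Matrix (Fin 2) (Fin 2) ℝ :=
  -((IIOf y ν p)ᵀ * (IOf y p)⁻¹)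

/-- Gaussian curvature of an immersion `y` with unit normal `ν`. -/
def KgOf (y ν : Pt → Fin 3 → ℝ) (p : Pt) : ℝ :=
  (IIOf y ν p).det / (IOf y p).det

/-- Mean curvature of an immersion `y` with unit normal `ν`. -/
def HmOf (y ν : Pt → Fin 3 → ℝ) (p : Pt) : ℝ :=
  -(1 / 2) * (weinOf y ν p).trace

/-- Smaller principal curvature `H − √(H² − K)` of an immersion `y`. -/
def k1Of (y ν : Pt → Fin 3 → ℝ) (p : Pt) : ℝ :=
  HmOf y ν p - Real.sqrt ((HmOf y ν p) ^ 2 - KgOf y ν p)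

/-- Larger principal curvature `H + √(H² − K)` of an immersion `y`. -/
def k2Of (y ν : Pt → Fin 3 → ℝ) (p : Pt) : ℝ :=
  HmOf y ν p + Real.sqrt ((HmOf y ν p) ^ 2 - KgOf y ν p)

/-- A frontal `x : U → ℝ³` equipped with a tangent moving base (tmb) `Ω` and the
induced smooth matrix-valued maps `Λ`, `μ` satisfying `Dx = Ω Λᵀ` and `Dn = Ω μᵀ` on `U`. -/
structure Frontal where
  /-- the domain -/
  U : Set Pt
  isOpen_U : IsOpen U
  /-- the frontal -/
  x : Pt → Fin 3 → ℝ
  /-- the tangent moving base -/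
  Ω : Pt → Matrix (Fin 3) (Fin 2) ℝ
  /-- `Λ` with `Dx = Ω Λᵀ` -/
  Λ : Pt → Matrix (Fin 2) (Fin 2) ℝ
  /-- `μ` with `Dn = Ω μᵀ` -/
  μ : Pt → Matrix (Fin 2) (Fin 2) ℝ
  smooth_x : ContDiffOn ℝ (⊤ : ℕ∞) x U
  smooth_Ω : ∀ i j, ContDiffOn ℝ (⊤ : ℕ∞) (fun p => Ω p i j) U
  smooth_Λ : ∀ i j, ContDiffOn ℝ (⊤ : ℕ∞) (fun p => Λ p i j) U
  smooth_μ : ∀ i j, ContDiffOn ℝ (⊤ : ℕ∞) (fun p => μ p i j) U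
  /-- the columns of `Ω` are linearly independent (nonzero cross product) -/
  indep : ∀ p ∈ U, crossProduct (fun i => Ω p i 0) (fun i => Ω p i 1) ≠ 0
  decomp_x : ∀ p ∈ U, jac x p = Ω p * (Λ p)ᵀ
  decomp_n : ∀ p ∈ U, jac (normalOf Ω) p = Ω p * (μ p)ᵀ

namespace Frontal

variable (F : Frontal)

/-- The unit normal induced by the tmb. -/
def n : Pt → Fin 3 → ℝ := normalOf F.Ω

/-- `λ_Ω := det Λ`. -/
def lam (p : Pt) : ℝ := (F.Λ p).det

/-- The Ω-relative curvature `K_Ω := det μ`. -/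
def KΩ (p : Pt) : ℝ := (F.μ p).det

/-- `α_Ω := μ · adj(Λ)`. -/
def αΩ (p : Pt) : Matrix (Fin 2) (Fin 2) ℝ := F.μ p * (F.Λ p).adjugate

/-- The Ω-relative mean curvature `H_Ω := −(1/2) tr α_Ω`. -/
def HΩ (p : Pt) : ℝ := -(1 / 2) * (F.αΩ p).trace

/-- The relative principal curvature `k_{1Ω} := H_Ω − √(H_Ω² − λ_Ω K_Ω)`. -/
def k1Ω (p : Pt) : ℝ := F.HΩ p - Real.sqrt ((F.HΩ p) ^ 2 - F.lam p * F.KΩ p)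

/-- The relative principal curvature `k_{2Ω} := H_Ω + √(H_Ω² − λ_Ω K_Ω)`. -/
def k2Ω (p : Pt) : ℝ := F.HΩ p + Real.sqrt ((F.HΩ p) ^ 2 - F.lam p * F.KΩ p)

/-- The singular set `Σ(x) = λ_Ω⁻¹(0)`. -/
def sing : Set Pt := {p ∈ F.U | F.lam p = 0}

/-- The regular set `U − Σ(x)`. -/
def reg : Set Pt := {p ∈ F.U | F.lam p ≠ 0}

/-- A frontal is proper if its singular set has empty interior. -/
def IsProper : Prop := interior F.sing = ∅

/-- `x` is a wavefront if `(x, n) : U → ℝ³ × S²` is an immersion. -/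
def IsWavefront : Prop :=
  ∀ p ∈ F.U, (Matrix.fromRows (jac F.x p) (jac F.n p)).rank = 2

/-- First fundamental form matrix `I = Dxᵀ Dx`. -/
def Imat (p : Pt) : Matrix (Fin 2) (Fin 2) ℝ := IOf F.x p

/-- Second fundamental form matrix `II = −Dxᵀ Dn`. -/
def IImat (p : Pt) : Matrix (Fin 2) (Fin 2) ℝ := IIOf F.x F.n p

/-- Weingarten matrix `α := −IIᵀ I⁻¹` (meaningful off the singular set). -/
def Wein (p : Pt) : Matrix (Fin 2) (Fin 2) ℝ := weinOf F.x F.n p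

/-- Coefficient `e` of the second fundamental form. -/
def e (p : Pt) : ℝ := F.IImat p 0 0

/-- Coefficient `f` of the second fundamental form. -/
def f (p : Pt) : ℝ := F.IImat p 0 1

/-- Coefficient `g` of the second fundamental form. -/
def g (p : Pt) : ℝ := F.IImat p 1 1

/-- Gaussian curvature (meaningful off the singular set). -/
def Kg (p : Pt) : ℝ := KgOf F.x F.n p

/-- Mean curvature (meaningful off the singular set). -/
def Hm (p : Pt) : ℝ := HmOf F.x F.n p

/-- Principal curvature `κ₋ := H − √(H² − K)`. -/
def κm (p : Pt) : ℝ := F.Hm p - Real.sqrt ((F.Hm p) ^ 2 - F.Kg p)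

/-- Principal curvature `κ₊ := H + √(H² − K)`. -/
def κp (p : Pt) : ℝ := F.Hm p + Real.sqrt ((F.Hm p) ^ 2 - F.Kg p)

/-- `k₁ := κ₋` where `λ_Ω > 0` and `k₁ := κ₊` where `λ_Ω < 0`. -/
def k1 (p : Pt) : ℝ := if 0 < F.lam p then F.κm p else F.κp p

/-- `k₂ := κ₊` where `λ_Ω > 0` and `k₂ := κ₋` where `λ_Ω < 0`. -/
def k2 (p : Pt) : ℝ := if 0 < F.lam p then F.κp p else F.κm p

/-- `x` is parallelly smoothable at `p` : for some `ε > 0` and some open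
neighborhood `V` of `p`, `rank D(x + l·n)(q) = 2` for all `(q,l) ∈ V × (0,ε)`
or for all `(q,l) ∈ V × (−ε,0)`. -/
def ParSmoothable (p : Pt) : Prop :=
  ∃ ε > (0 : ℝ), ∃ V : Set Pt, IsOpen V ∧ p ∈ V ∧ V ⊆ F.U ∧
    ((∀ q ∈ V, ∀ l ∈ Set.Ioo (0 : ℝ) ε,
        (jac (fun z => F.x z + l • F.n z) q).rank = 2) ∨
     (∀ q ∈ V, ∀ l ∈ Set.Ioo (-ε) (0 : ℝ),
        (jac (fun z => F.x z + l • F.n z) q).rank = 2))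

/-- `f` (defined off the singular set) has a `C^∞` extension to `V`. -/
def SmoothExtOn (f : Pt → ℝ) (V : Set Pt) : Prop :=
  ∃ g : Pt → ℝ, ContDiffOn ℝ (⊤ : ℕ∞) g V ∧ ∀ q ∈ V ∩ F.reg, g q = f q

/-- `f` has a `C^∞` extension to some open neighborhood of `p`. -/
def SmoothExtNear (f : Pt → ℝ) (p : Pt) : Prop :=
  ∃ V : Set Pt, IsOpen V ∧ p ∈ V ∧ V ⊆ F.U ∧ F.SmoothExtOn f V

/-- Membership in the principal ideal `𝔗_Ω(V)` generated by `λ_Ω` in `C^∞(V,ℝ)`. -/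
def memIdeal (f : Pt → ℝ) (V : Set Pt) : Prop :=
  ∃ φ : Pt → ℝ, ContDiffOn ℝ (⊤ : ℕ∞) φ V ∧ ∀ q ∈ V, f q = φ q * F.lam q

end Frontal

/-- `f` does not change sign on `V`. -/
def NoSignChange (f : Pt → ℝ) (V : Set Pt) : Prop :=
  (∀ q ∈ V, 0 ≤ f q) ∨ (∀ q ∈ V, f q ≤ 0)

/-- A punctured ball in a real normed space of dimension greater than one is preconnected. -/
lemma isPreconnected_ball_diff_singleton {E : Type*} [NormedAddCommGroup E] [NormedSpace ℝ E]
    (h : 1 < Module.rank ℝ E) (c : E) {r : ℝ} (hr : 0 < r) :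
    IsPreconnected (Metric.ball c r \ {c}) := by
  let e := Homeomorph.unitBall (E := E)
  let φ : E → E := fun x => c + r • (e x : E)
  have hφ : Continuous φ := by fun_prop
  have he0 : (e 0 : E) = 0 := Homeomorph.coe_unitBall_apply_zero
  have himage : φ '' {0}ᶜ = Metric.ball c r \ {c} := by
    ext y
    constructor
    · rintro ⟨x, hx, rfl⟩
      have h1 : ‖(e x : E)‖ < 1 := mem_ball_zero_iff.1 (e x).2
      refine ⟨?_, ?_⟩
      · rw [mem_ball_iff_norm]
        simp only [φ, add_sub_cancel_left, norm_smul, Real.norm_eq_abs, abs_of_pos hr]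
        nlinarith
      · intro hc
        have h2 : (e x : E) = 0 := by
          simpa [φ, hr.ne'] using hc
        exact hx (e.injective (Subtype.ext (h2.trans he0.symm)))
    · rintro ⟨hy, hyc⟩
      rw [mem_ball_iff_norm] at hy
      have hmem : r⁻¹ • (y - c) ∈ Metric.ball (0 : E) 1 := by
        rw [mem_ball_zero_iff, norm_smul, Real.norm_eq_abs, abs_of_pos (inv_pos.2 hr),
          inv_mul_lt_iff₀ hr]
        simpa using hy
      have hφy : φ (e.symm ⟨_, hmem⟩) = y := by
        simp [φ, smul_smul, hr.ne']
      refine ⟨e.symm ⟨_, hmem⟩, fun h0 => hyc ?_, hφy⟩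
      rw [Set.mem_singleton_iff] at h0 ⊢
      rw [← hφy, h0]
      simp [φ, he0]
  rw [← himage]
  exact (isConnected_compl_singleton_of_one_lt_rank h 0).isPreconnected.image φ hφ.continuousOn

/-- If `n` is orthogonal to the derivative of `x` near `p`, then the second fundamental form
`(v, w) ↦ ⟨Dx v, Dn w⟩` is symmetric at `p`. -/
lemma fderiv_dotProduct_fderiv_comm {x n : Pt → Fin 3 → ℝ} {p : Pt} (hx : ContDiffAt ℝ 2 x p)
    (hn : DifferentiableAt ℝ n p) (h : ∀ᶠ z in 𝓝 p, ∀ v, fderiv ℝ x z v ⬝ᵥ n z = 0) (v w : Pt) :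
    fderiv ℝ x p v ⬝ᵥ fderiv ℝ n p w = fderiv ℝ x p w ⬝ᵥ fderiv ℝ n p v := by
  have hdx : DifferentiableAt ℝ (fderiv ℝ x) p :=
    (hx.fderiv_right (m := 1) (by norm_num)).differentiableAt one_ne_zero
  have key : ∀ v w, fderiv ℝ (fderiv ℝ x) p w v ⬝ᵥ n p
      + fderiv ℝ x p v ⬝ᵥ fderiv ℝ n p w = 0 := by
    intro v w
    have h1 : HasFDerivAt (fun z => fderiv ℝ x z v ⬝ᵥ n z)
        (∑ k, (fderiv ℝ x p v k • (ContinuousLinearMap.proj k ∘L fderiv ℝ n p)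
          + n p k • (ContinuousLinearMap.proj k ∘L
            (ContinuousLinearMap.apply ℝ (Fin 3 → ℝ) v ∘L fderiv ℝ (fderiv ℝ x) p)))) p := by
      refine HasFDerivAt.fun_sum fun k _ => HasFDerivAt.mul ?_ ?_
      · exact (ContinuousLinearMap.proj (R := ℝ) (φ := fun _ : Fin 3 => ℝ) k ∘L
          ContinuousLinearMap.apply ℝ (Fin 3 → ℝ) v).hasFDerivAt.comp p hdx.hasFDerivAt
      · exact (ContinuousLinearMap.proj (R := ℝ) (φ := fun _ : Fin 3 => ℝ) k).hasFDerivAt.comp p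
          hn.hasFDerivAt
    have h2 : HasFDerivAt (fun z => fderiv ℝ x z v ⬝ᵥ n z) (0 : Pt →L[ℝ] ℝ) p :=
      (hasFDerivAt_const (0 : ℝ) p).congr_of_eventuallyEq (h.mono fun z hz => hz v)
    have h3 := congrArg (fun L : Pt →L[ℝ] ℝ => L w) (h1.unique h2)
    simp only [Fin.sum_univ_three, _root_.add_apply, _root_.smul_apply,
      ContinuousLinearMap.comp_apply, ContinuousLinearMap.proj_apply, smul_eq_mul,
      ContinuousLinearMap.apply_apply, _root_.zero_apply] at h3
    simp only [dotProduct, Fin.sum_univ_three]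
    linarith
  have hsymm : fderiv ℝ (fderiv ℝ x) p v w = fderiv ℝ (fderiv ℝ x) p w v :=
    (hx.isSymmSndFDerivAt (by simp)) v w
  have h1 := key v w
  have h2 := key w v
  rw [hsymm] at h2
  linarith

/-- The Gram determinant of the columns of a `3 × 2` matrix is the squared length of their
cross product. -/
lemma det_transpose_mul_self_eq_cross (A : Matrix (Fin 3) (Fin 2) ℝ) :
    (Aᵀ * A).det = crossProduct (fun i => A i 0) (fun i => A i 1) ⬝ᵥ
      crossProduct (fun i => A i 0) (fun i => A i 1) := by
  simp [Matrix.det_fin_two, Matrix.mul_apply, Fin.sum_univ_three, cross_apply]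
  ring

lemma rank_eq_two_of_cross_ne_zero {A : Matrix (Fin 3) (Fin 2) ℝ}
    (h : crossProduct (fun i => A i 0) (fun i => A i 1) ≠ 0) : A.rank = 2 := by
  have hdet : IsUnit (Aᵀ * A).det := by
    rw [det_transpose_mul_self_eq_cross, isUnit_iff_ne_zero]
    exact fun h0 => h (dotProduct_self_eq_zero.1 h0)
  have := Matrix.rank_of_isUnit _ ((Matrix.isUnit_iff_isUnit_det _).2 hdet)
  rwa [Matrix.rank_transpose_mul_self, Fintype.card_fin] at this

lemma mulVec_injective_of_rank_eq_two {m : Type*} [Fintype m] {A : Matrix m (Fin 2) ℝ}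
    (h : A.rank = 2) : Function.Injective A.mulVec := by
  have h1 := LinearMap.finrank_range_add_finrank_ker A.mulVecLin
  have h2 : Module.finrank ℝ (LinearMap.range A.mulVecLin) = 2 := h
  rw [h2, Module.finrank_fin_fun] at h1
  have h3 : LinearMap.ker A.mulVecLin = ⊥ := Submodule.finrank_eq_zero.1 (by omega)
  exact LinearMap.ker_eq_bot.1 h3

/-- Let `L`, `M` satisfy `L G Mᵀ = M G Lᵀ` for a positive definite form `G = AᵀA`, and suppose
`L` is singular and nonzero. If the mixed discriminant `tr (adj L · M)` vanishes, then
`Lᵀ` and `Mᵀ` have a common kernel vector. -/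
lemma exists_common_kernel {A : Matrix (Fin 3) (Fin 2) ℝ} (hA : Function.Injective A.mulVec)
    {L M : Matrix (Fin 2) (Fin 2) ℝ} (hL : L ≠ 0) (hdet : L.det = 0)
    (hsymm : (A *ᵥ L 0) ⬝ᵥ (A *ᵥ M 1) = (A *ᵥ L 1) ⬝ᵥ (A *ᵥ M 0))
    (htr : L 1 1 * M 0 0 + L 0 0 * M 1 1 - L 0 1 * M 1 0 - L 1 0 * M 0 1 = 0) :
    ∃ v : Fin 2 → ℝ, v ≠ 0 ∧ Lᵀ *ᵥ v = 0 ∧ Mᵀ *ᵥ v = 0 := by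
  have main : ∀ (a b c d : Fin 2 → ℝ), a ≠ 0 → a 0 * b 1 - a 1 * b 0 = 0 →
      (A *ᵥ a) ⬝ᵥ (A *ᵥ d) = (A *ᵥ b) ⬝ᵥ (A *ᵥ c) →
      b 1 * c 0 + a 0 * d 1 - a 1 * d 0 - b 0 * c 1 = 0 →
      ∃ t : ℝ, b = t • a ∧ d = t • c := by
    have par : ∀ (a b : Fin 2 → ℝ), a ≠ 0 → a 0 * b 1 - a 1 * b 0 = 0 → ∃ t : ℝ, b = t • a := by
      intro a b ha hab
      by_cases h0 : a 0 = 0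
      · have h1 : a 1 ≠ 0 := fun h1 => ha (by ext i; fin_cases i <;> simp [h0, h1])
        refine ⟨b 1 / a 1, ?_⟩
        ext i
        fin_cases i
        · simp [h0]
          simpa [h0, h1] using hab
        · simp [h1]
      · refine ⟨b 0 / a 0, ?_⟩
        ext i
        fin_cases i
        · simp [h0]
        · simp
          field_simp
          linarith
    intro a b c d ha hab hs ht
    obtain ⟨t, rfl⟩ := par a b ha hab
    obtain ⟨s, hs'⟩ := par a (d - t • c) ha (by simp at ht ⊢; linarith)
    have hd : d = t • c + s • a := by rw [← hs']; abel
    have hpos : (A *ᵥ a) ⬝ᵥ (A *ᵥ a) ≠ 0 := by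
      intro h0
      exact ha (hA (by rw [dotProduct_self_eq_zero.1 h0]; simp))
    have hs0 : s = 0 := by
      rw [hd] at hs
      simp only [Matrix.mulVec_add, Matrix.mulVec_smul, dotProduct_add, dotProduct_smul,
        smul_dotProduct, smul_eq_mul] at hs
      exact (mul_eq_zero.1 (by linarith : s * _ = 0)).resolve_right hpos
    exact ⟨t, rfl, by simp [hd, hs0]⟩
  rw [Matrix.det_fin_two] at hdet
  by_cases h0 : L 0 = 0
  · have h1 : L 1 ≠ 0 := by
      intro h1
      apply hL
      ext i j
      fin_cases i
      · exact congrFun h0 j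
      · exact congrFun h1 j
    obtain ⟨t, hb, hd⟩ := main (L 1) (L 0) (M 1) (M 0) h1 (by linarith) hsymm.symm (by linarith)
    refine ⟨![-1, t], fun h => by simpa using congrFun h 0, ?_, ?_⟩ <;> ext j
    · have := congrFun hb j
      simp [Matrix.mulVec, dotProduct] at this ⊢
      linarith
    · have := congrFun hd j
      simp [Matrix.mulVec, dotProduct] at this ⊢
      linarith
  · obtain ⟨t, hb, hd⟩ := main (L 0) (L 1) (M 0) (M 1) h0 (by linarith) hsymm (by linarith)
    refine ⟨![t, -1], fun h => by simpa using congrFun h 1, ?_, ?_⟩ <;> ext j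
    · have := congrFun hb j
      simp [Matrix.mulVec, dotProduct] at this ⊢
      linarith
    · have := congrFun hd j
      simp [Matrix.mulVec, dotProduct] at this ⊢
      linarith

lemma jac_mulVec {m : ℕ} (f : Pt → Fin m → ℝ) (p v : Pt) : jac f p *ᵥ v = fderiv ℝ f p v := by
  have hv : v = v 0 • Pi.single 0 1 + v 1 • Pi.single 1 1 := by
    ext i; fin_cases i <;> simp
  ext i
  conv_rhs => rw [hv, map_add, map_smul, map_smul]
  simp [jac, Matrix.mulVec, dotProduct, Fin.sum_univ_two, mul_comm]

namespace Frontal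

variable (F : Frontal)

lemma differentiableAt_x {q : Pt} (hq : q ∈ F.U) : DifferentiableAt ℝ F.x q :=
  (F.smooth_x.contDiffAt (F.isOpen_U.mem_nhds hq)).differentiableAt (by simp)

lemma differentiableAt_n {q : Pt} (hq : q ∈ F.U) : DifferentiableAt ℝ F.n q := by
  have hΩ : ∀ i j, DifferentiableAt ℝ (fun z => F.Ω z i j) q := fun i j =>
    ((F.smooth_Ω i j).contDiffAt (F.isOpen_U.mem_nhds hq)).differentiableAt (by simp)
  have hc : DifferentiableAt ℝ
      (fun z => crossProduct (fun i => F.Ω z i 0) (fun i => F.Ω z i 1)) q := by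
    rw [differentiableAt_pi]
    intro k
    fin_cases k <;> simp [cross_apply] <;>
      exact ((hΩ _ _).mul (hΩ _ _)).sub ((hΩ _ _).mul (hΩ _ _))
  have hcc := differentiableAt_pi.1 hc
  have hne : crossProduct (fun i => F.Ω q i 0) (fun i => F.Ω q i 1) ⬝ᵥ
      crossProduct (fun i => F.Ω q i 0) (fun i => F.Ω q i 1) ≠ 0 :=
    fun h0 => F.indep q hq (dotProduct_self_eq_zero.1 h0)
  have hd : DifferentiableAt ℝ (fun z => crossProduct (fun i => F.Ω z i 0) (fun i => F.Ω z i 1) ⬝ᵥ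
      crossProduct (fun i => F.Ω z i 0) (fun i => F.Ω z i 1)) q :=
    DifferentiableAt.fun_sum fun k _ => (hcc k).mul (hcc k)
  have hs : DifferentiableAt ℝ
      (fun z => enorm3 (crossProduct (fun i => F.Ω z i 0) (fun i => F.Ω z i 1))) q := hd.sqrt hne
  refine DifferentiableAt.smul (hs.inv ?_) hc
  exact Real.sqrt_ne_zero'.2 (lt_of_le_of_ne
    (Finset.sum_nonneg fun _ _ => mul_self_nonneg _) hne.symm)

lemma fderiv_x_dotProduct_n {q : Pt} (hq : q ∈ F.U) (v : Pt) : fderiv ℝ F.x q v ⬝ᵥ F.n q = 0 := by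
  rw [← jac_mulVec, F.decomp_x q hq, ← Matrix.mulVec_mulVec]
  generalize (F.Λ q)ᵀ *ᵥ v = w
  simp [n, normalOf, Matrix.mulVec, dotProduct, Fin.sum_univ_three, cross_apply]
  ring

/-- The mixed term of `det (Λ + l μ)`, equal to `-2 H_Ω`. -/
lemma neg_two_mul_HΩ (q : Pt) : -2 * F.HΩ q = F.Λ q 1 1 * F.μ q 0 0 + F.Λ q 0 0 * F.μ q 1 1
    - F.Λ q 0 1 * F.μ q 1 0 - F.Λ q 1 0 * F.μ q 0 1 := by
  simp [HΩ, αΩ, Matrix.trace_fin_two, Matrix.mul_apply, Matrix.adjugate_fin_two]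
  ring

/-- At a rank-one singular point of a wavefront the relative mean curvature does not vanish. -/
lemma HΩ_ne_zero (hW : F.IsWavefront) {p : Pt} (hp : p ∈ F.sing) (hr : (jac F.x p).rank = 1) :
    F.HΩ p ≠ 0 := by
  intro hH
  obtain ⟨hpU, hlam⟩ := hp
  have hdn : jac F.n p = F.Ω p * (F.μ p)ᵀ := F.decomp_n p hpU
  have hsymm := fderiv_dotProduct_fderiv_comm
    ((F.smooth_x.contDiffAt (F.isOpen_U.mem_nhds hpU)).of_le
      (WithTop.coe_le_coe.2 (le_top : (2 : ℕ∞) ≤ ⊤)))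
    (F.differentiableAt_n hpU)
    (Filter.mem_of_superset (F.isOpen_U.mem_nhds hpU) fun z hz v =>
      F.fderiv_x_dotProduct_n hz v)
    (Pi.single 0 1) (Pi.single 1 1)
  simp only [← jac_mulVec, F.decomp_x p hpU, hdn, ← Matrix.mulVec_mulVec] at hsymm
  simp only [Matrix.mulVec_single_one] at hsymm
  obtain ⟨v, hv, h1, h2⟩ := exists_common_kernel (L := F.Λ p) (M := F.μ p)
    (mulVec_injective_of_rank_eq_two (rank_eq_two_of_cross_ne_zero (F.indep p hpU)))
    (fun h0 => by simp [F.decomp_x p hpU, h0] at hr) hlam hsymm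
    (by rw [← F.neg_two_mul_HΩ, hH, mul_zero])
  refine hv (mulVec_injective_of_rank_eq_two (hW p hpU) ?_)
  rw [Matrix.fromRows_mulVec, F.decomp_x p hpU, hdn, ← Matrix.mulVec_mulVec,
    ← Matrix.mulVec_mulVec, h1, h2]
  ext i
  cases i <;> simp

lemma det_add_smul (q : Pt) (l : ℝ) :
    (F.Λ q + l • F.μ q).det = F.lam q + l * (-2 * F.HΩ q + l * F.KΩ q) := by
  rw [F.neg_two_mul_HΩ]
  simp [lam, KΩ, Matrix.det_fin_two]
  ring

lemma rank_jac_parallel {q : Pt} (hq : q ∈ F.U) {l : ℝ}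
    (h : F.lam q + l * (-2 * F.HΩ q + l * F.KΩ q) ≠ 0) :
    (jac (fun z => F.x z + l • F.n z) q).rank = 2 := by
  have hjac : jac (fun z => F.x z + l • F.n z) q = F.Ω q * (F.Λ q + l • F.μ q)ᵀ := by
    have hn : jac F.n q = F.Ω q * (F.μ q)ᵀ := F.decomp_n q hq
    rw [Matrix.transpose_add, Matrix.transpose_smul, Matrix.mul_add, Matrix.mul_smul,
      ← F.decomp_x q hq, ← hn]
    ext i j
    have := ((F.differentiableAt_x hq).hasFDerivAt.add
      ((F.differentiableAt_n hq).hasFDerivAt.const_smul l)).fderiv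
    change fderiv ℝ (F.x + l • F.n) q _ i = _
    rw [this]
    simp [jac]
  rw [hjac, Matrix.rank_mul_eq_left_of_isUnit_det]
  · exact rank_eq_two_of_cross_ne_zero (F.indep q hq)
  · rw [Matrix.det_transpose, F.det_add_smul]
    exact isUnit_iff_ne_zero.2 h

lemma continuousOn_entry_Λ (i j : Fin 2) : ContinuousOn (fun q => F.Λ q i j) F.U :=
  (F.smooth_Λ i j).continuousOn

lemma continuousOn_entry_μ (i j : Fin 2) : ContinuousOn (fun q => F.μ q i j) F.U :=
  (F.smooth_μ i j).continuousOn

lemma continuousOn_lam : ContinuousOn F.lam F.U := by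
  have := F.continuousOn_entry_Λ
  exact (((this 0 0).mul (this 1 1)).sub ((this 0 1).mul (this 1 0))).congr
    fun q _ => Matrix.det_fin_two (F.Λ q)

lemma continuousOn_KΩ : ContinuousOn F.KΩ F.U := by
  have := F.continuousOn_entry_μ
  exact (((this 0 0).mul (this 1 1)).sub ((this 0 1).mul (this 1 0))).congr
    fun q _ => Matrix.det_fin_two (F.μ q)

lemma continuousOn_HΩ : ContinuousOn F.HΩ F.U := by
  have hΛ := F.continuousOn_entry_Λ
  have hμ := F.continuousOn_entry_μ
  have h : ContinuousOn (fun q => -(1 / 2) * (F.Λ q 1 1 * F.μ q 0 0 + F.Λ q 0 0 * F.μ q 1 1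
      - F.Λ q 0 1 * F.μ q 1 0 - F.Λ q 1 0 * F.μ q 0 1)) F.U := by fun_prop
  exact h.congr fun q _ => by linear_combination -(1 / 2) * F.neg_two_mul_HΩ q

/-- Near an isolated singular point, `λ_Ω` has constant sign. -/
lemma exists_ball_noSignChange {p : Pt} (hp : p ∈ F.sing)
    (hiso : ∃ V : Set Pt, IsOpen V ∧ p ∈ V ∧ V ∩ F.sing = {p}) :
    ∃ r > 0, Metric.ball p r ⊆ F.U ∧ NoSignChange F.lam (Metric.ball p r) := by
  obtain ⟨V, hV, hpV, hVs⟩ := hiso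
  obtain ⟨r, hr, hball⟩ := Metric.isOpen_iff.1 (hV.inter F.isOpen_U) p ⟨hpV, hp.1⟩
  refine ⟨r, hr, fun q hq => (hball hq).2, ?_⟩
  have hconn : IsPreconnected (F.lam '' (Metric.ball p r \ {p})) :=
    (isPreconnected_ball_diff_singleton
      (Module.one_lt_rank_of_one_lt_finrank (by simp)) p hr).image F.lam
      (F.continuousOn_lam.mono fun q hq => (hball hq.1).2)
  have hne : (0 : ℝ) ∉ F.lam '' (Metric.ball p r \ {p}) := by
    rintro ⟨q, hq, hq0⟩
    have : q ∈ V ∩ F.sing := ⟨(hball hq.1).1, (hball hq.1).2, hq0⟩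
    rw [hVs] at this
    exact hq.2 this
  by_contra hcon
  simp only [NoSignChange, not_or, not_forall, not_le] at hcon
  obtain ⟨⟨a, ha, ha0⟩, b, hb, hb0⟩ := hcon
  refine hne (hconn.Icc_subset ⟨a, ⟨ha, ?_⟩, rfl⟩ ⟨b, ⟨hb, ?_⟩, rfl⟩ ⟨ha0.le, hb0.le⟩)
  · rintro rfl
    exact ha0.ne hp.2
  · rintro rfl
    exact hb0.ne' hp.2

end Frontal

/-- If `c p > 0`, then `c + l k` is positive near `(p, 0)`. -/
lemma exists_ball_add_mul_pos {U : Set Pt} (hU : IsOpen U) {c k : Pt → ℝ} (hc : ContinuousOn c U)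
    (hk : ContinuousOn k U) {p : Pt} (hp : p ∈ U) (h : 0 < c p) :
    ∃ δ > 0, ∀ q ∈ Metric.ball p δ, ∀ l ∈ Set.Ioo (-δ) δ, 0 < c q + l * k q := by
  have hcont : ContinuousAt (fun z : Pt × ℝ => c z.1 + z.2 * k z.1) (p, 0) := by
    have hc' : ContinuousAt (fun z : Pt × ℝ => c z.1) (p, 0) :=
      ContinuousAt.comp (f := Prod.fst) (hc.continuousAt (hU.mem_nhds hp)) continuousAt_fst
    have hk' : ContinuousAt (fun z : Pt × ℝ => k z.1) (p, 0) :=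
      ContinuousAt.comp (f := Prod.fst) (hk.continuousAt (hU.mem_nhds hp)) continuousAt_fst
    exact hc'.add (continuousAt_snd.mul hk')
  have hev : ∀ᶠ z : Pt × ℝ in 𝓝 (p, 0), 0 < c z.1 + z.2 * k z.1 :=
    hcont.eventually (lt_mem_nhds (by simpa using h))
  obtain ⟨δ, hδ, hball⟩ := Metric.eventually_nhds_iff_ball.1 hev
  refine ⟨δ, hδ, fun q hq l hl => hball (q, l) ?_⟩
  rw [← ball_prod_same]
  exact ⟨hq, by simpa [Real.dist_eq, abs_lt] using hl⟩

/-- at a rank-1 singularity of a wavefront, if `p` is an isolated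
point of the singular set then `x` is parallelly smoothable at `p`. -/
theorem stmt16 (F : Frontal) (hW : F.IsWavefront)
    (p : Pt) (hp : p ∈ F.sing) (hr : (jac F.x p).rank = 1)
    (hiso : ∃ V : Set Pt, IsOpen V ∧ p ∈ V ∧ V ∩ F.sing = {p}) :
    F.ParSmoothable p := by
  obtain ⟨r, hr0, hrU, hsign⟩ := F.exists_ball_noSignChange hp hiso
  obtain ⟨s, hs, hsH⟩ : ∃ s : ℝ, (s = 1 ∨ s = -1) ∧ 0 < s * (-2 * F.HΩ p) := by
    rcases lt_or_gt_of_ne (F.HΩ_ne_zero hW hp hr) with h | h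
    · exact ⟨1, .inl rfl, by linarith⟩
    · exact ⟨-1, .inr rfl, by linarith⟩
  obtain ⟨δ, hδ, hpos⟩ := exists_ball_add_mul_pos F.isOpen_U
    (c := fun q => s * (-2 * F.HΩ q)) (k := fun q => s * F.KΩ q)
    (continuousOn_const.mul (continuousOn_const.mul F.continuousOn_HΩ))
    (continuousOn_const.mul F.continuousOn_KΩ) hp.1 hsH
  refine ⟨δ, hδ, Metric.ball p r ∩ Metric.ball p δ, Metric.isOpen_ball.inter Metric.isOpen_ball,
    ⟨Metric.mem_ball_self hr0, Metric.mem_ball_self hδ⟩, fun q hq => hrU hq.1, ?_⟩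
  have hfac : ∀ q ∈ Metric.ball p δ, ∀ l ∈ Set.Ioo (-δ) δ,
      0 < s * (-2 * F.HΩ q + l * F.KΩ q) := fun q hq l hl => by
    linear_combination hpos q hq l hl
  rcases hsign with hsign | hsign <;> rcases hs with rfl | rfl
  · refine .inl fun q hq l hl => F.rank_jac_parallel (hrU hq.1) (ne_of_gt ?_)
    nlinarith [hsign q hq.1, mul_pos hl.1 (hfac q hq.2 l ⟨by linarith [hl.1], hl.2⟩)]
  · refine .inr fun q hq l hl => F.rank_jac_parallel (hrU hq.1) (ne_of_gt ?_)
    nlinarith [hsign q hq.1, mul_pos (neg_pos.2 hl.2) (hfac q hq.2 l ⟨hl.1, by linarith [hl.2]⟩)]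
  · refine .inr fun q hq l hl => F.rank_jac_parallel (hrU hq.1) (ne_of_lt ?_)
    nlinarith [hsign q hq.1, mul_pos (neg_pos.2 hl.2) (hfac q hq.2 l ⟨hl.1, by linarith [hl.2]⟩)]
  · refine .inl fun q hq l hl => F.rank_jac_parallel (hrU hq.1) (ne_of_lt ?_)
    nlinarith [hsign q hq.1, mul_pos hl.1 (hfac q hq.2 l ⟨by linarith [hl.1], hl.2⟩)]
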